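/- Let q be a complex number with |q| < 1. Then Σ_{i,j≥0} (−1)^j · q^(i²+2ij+j²) / ((q⁸;q⁸)_i · (q⁸;q⁸)_j) = 1 / ((−q⁸;q⁸)_∞ · (q⁴;q²⁰)_∞ · (q¹⁶;q²⁰)_∞). (This is the Chen–Yin identity Σ_{i,j≥0} (−1)^j q^(i²/4+ij/2+j²/4) / ((q²;q²)_i (q²;q²)_j) = 1/((−q²;q²)_∞ (q, q⁴; q⁵)_∞) after the substitution q ↦ q⁴.) -/

import Mathlib

/-- Finite q-Pochhammer symbol `(a; q)_n = ∏_{k=0}^{n-1} (1 - a q^k)`. -/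
noncomputable def qPoch (a q : ℂ) (n : ℕ) : ℂ := ∏ k ∈ Finset.range n, (1 - a * q ^ k)

/-- Infinite q-Pochhammer symbol `(a; q)_∞ = ∏_{k=0}^{∞} (1 - a q^k)`. -/
noncomputable def qPochInf (a q : ℂ) : ℂ := ∏' k : ℕ, (1 - a * q ^ k)

open Filter Topology

section QPoch

theorem qPoch_succ (a q : ℂ) (n : ℕ) : qPoch a q (n + 1) = qPoch a q n * (1 - a * q ^ n) :=
  Finset.prod_range_succ _ _

theorem summable_norm_mul_pow (a : ℂ) {q : ℂ} (hq : ‖q‖ < 1) :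
    Summable fun k : ℕ => ‖-(a * q ^ k)‖ := by
  simpa [norm_mul, norm_pow] using
    (summable_geometric_of_lt_one (norm_nonneg q) hq).mul_left ‖a‖

theorem multipliable_one_sub_mul_pow (a : ℂ) {q : ℂ} (hq : ‖q‖ < 1) :
    Multipliable fun k : ℕ => 1 - a * q ^ k := by
  simpa [sub_eq_add_neg] using multipliable_one_add_of_summable (summable_norm_mul_pow a hq)

theorem tendsto_qPoch (a : ℂ) {q : ℂ} (hq : ‖q‖ < 1) :
    Tendsto (qPoch a q) atTop (𝓝 (qPochInf a q)) :=
  (multipliable_one_sub_mul_pow a hq).tendsto_prod_tprod_nat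

theorem qPochInf_ne_zero {a q : ℂ} (hq : ‖q‖ < 1) (h : ∀ k : ℕ, 1 - a * q ^ k ≠ 0) :
    qPochInf a q ≠ 0 := by
  have := tprod_one_add_ne_zero_of_summable (f := fun k : ℕ => -(a * q ^ k))
    (fun k => by simpa [sub_eq_add_neg] using h k) (summable_norm_mul_pow a hq)
  simpa [qPochInf, sub_eq_add_neg] using this

theorem one_sub_mul_pow_ne_zero {a q : ℂ} (ha : ‖a‖ < 1) (hq : ‖q‖ < 1) (k : ℕ) :
    1 - a * q ^ k ≠ 0 := by
  intro h
  have h1 : ‖a * q ^ k‖ = 1 := by rw [← sub_eq_zero.mp h, norm_one]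
  rw [norm_mul, norm_pow] at h1
  have h2 : ‖q‖ ^ k ≤ 1 := pow_le_one₀ (norm_nonneg q) hq.le
  nlinarith [norm_nonneg a, pow_nonneg (norm_nonneg q) k]

theorem qPochInf_ne_zero_of_norm_lt_one {a q : ℂ} (ha : ‖a‖ < 1) (hq : ‖q‖ < 1) :
    qPochInf a q ≠ 0 :=
  qPochInf_ne_zero hq (one_sub_mul_pow_ne_zero ha hq)

theorem qPoch_ne_zero {a q : ℂ} (ha : ‖a‖ < 1) (hq : ‖q‖ < 1) (n : ℕ) : qPoch a q n ≠ 0 :=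
  Finset.prod_ne_zero_iff.mpr fun k _ => one_sub_mul_pow_ne_zero ha hq k

theorem qPochInf_eq_qPoch_mul (a : ℂ) {q : ℂ} (hq : ‖q‖ < 1) (n : ℕ) :
    qPochInf a q = qPoch a q n * qPochInf (a * q ^ n) q := by
  refine tendsto_nhds_unique ((tendsto_add_atTop_iff_nat n).mpr (tendsto_qPoch a hq)) ?_
  refine ((tendsto_qPoch (a * q ^ n) hq).const_mul (qPoch a q n)).congr fun k => ?_
  rw [qPoch, qPoch, qPoch, add_comm k n, Finset.prod_range_add]
  simp [pow_add, mul_assoc]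

theorem qPoch_sq_sq (a q : ℂ) (n : ℕ) :
    qPoch (a ^ 2) (q ^ 2) n = qPoch a q n * qPoch (-a) q n := by
  simp only [qPoch, ← Finset.prod_mul_distrib]
  exact Finset.prod_congr rfl fun k _ => by ring

/-- Splitting `(q; q)_∞` according to the residues of the exponents modulo `5`. -/
theorem qPochInf_self_eq_prod_five {q : ℂ} (hq : ‖q‖ < 1) :
    qPochInf q q = qPochInf q (q ^ 5) * qPochInf (q ^ 2) (q ^ 5) * qPochInf (q ^ 3) (q ^ 5) *
      qPochInf (q ^ 4) (q ^ 5) * qPochInf (q ^ 5) (q ^ 5) := by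
  have h5 : ‖q ^ 5‖ < 1 := by
    rw [norm_pow]; exact pow_lt_one₀ (norm_nonneg q) hq (by norm_num)
  have hlim := ((((tendsto_qPoch q h5).mul (tendsto_qPoch (q ^ 2) h5)).mul
    (tendsto_qPoch (q ^ 3) h5)).mul (tendsto_qPoch (q ^ 4) h5)).mul (tendsto_qPoch (q ^ 5) h5)
  refine tendsto_nhds_unique ((tendsto_qPoch q hq).comp
    (tendsto_id.const_mul_atTop' (show 0 < 5 by norm_num))) (hlim.congr fun n => ?_)
  simp only [Function.comp, id]
  induction n with
  | zero => simp [qPoch]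
  | succ n ih =>
    rw [show 5 * (n + 1) = 5 * n + 1 + 1 + 1 + 1 + 1 by ring]
    simp only [qPoch_succ]
    rw [← ih]
    ring

end QPoch

/-- The reciprocal `1 / (s²; s²)_m`, extended by zero to negative `m`. -/
noncomputable def qPochRecip (s : ℂ) (m : ℤ) : ℂ :=
  if 0 ≤ m then 1 / qPoch (s ^ 2) (s ^ 2) m.toNat else 0

section Recip

variable {s : ℂ}

theorem qPochRecip_of_neg {m : ℤ} (hm : m < 0) : qPochRecip s m = 0 := if_neg hm.not_ge

theorem qPochRecip_natCast (n : ℕ) : qPochRecip s n = 1 / qPoch (s ^ 2) (s ^ 2) n := by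
  simp [qPochRecip]

theorem qPochRecip_zero : qPochRecip s 0 = 1 := by simp [qPochRecip, qPoch]

theorem norm_sq_lt_one (hs : ‖s‖ < 1) : ‖s ^ 2‖ < 1 := by
  rw [norm_pow]; exact pow_lt_one₀ (norm_nonneg s) hs two_ne_zero

theorem one_sub_zpow_ne_zero (hs : ‖s‖ < 1) (n : ℕ) :
    1 - s ^ (2 * ((n : ℤ) + 1)) ≠ 0 := by
  have := one_sub_mul_pow_ne_zero (norm_sq_lt_one hs) (norm_sq_lt_one hs) n
  convert this using 2
  rw [← pow_succ', ← pow_mul]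
  exact_mod_cast rfl

theorem one_sub_zpow_mul_qPochRecip (hs : ‖s‖ < 1) (m : ℤ) :
    (1 - s ^ (2 * m)) * qPochRecip s m = qPochRecip s (m - 1) := by
  rcases lt_trichotomy m 0 with h | rfl | h
  · rw [qPochRecip_of_neg h, qPochRecip_of_neg (by lia), mul_zero]
  · rw [qPochRecip_of_neg (m := 0 - 1) (by lia)]; simp
  · obtain ⟨n, rfl⟩ : ∃ n : ℕ, m = n + 1 := ⟨(m - 1).toNat, by lia⟩
    have h1 := one_sub_zpow_ne_zero hs n
    have h2 := qPoch_ne_zero (norm_sq_lt_one hs) (norm_sq_lt_one hs) n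
    have h3 : s ^ (2 * ((n : ℤ) + 1)) = s ^ 2 * (s ^ 2) ^ n := by
      rw [← pow_succ', ← pow_mul]; exact_mod_cast rfl
    rw [add_sub_cancel_right, ← Nat.cast_succ, qPochRecip_natCast, qPochRecip_natCast,
      qPoch_succ, Nat.cast_succ, ← h3]
    field_simp

theorem tendsto_qPochRecip (hs : ‖s‖ < 1) :
    Tendsto (qPochRecip s) atTop (𝓝 (1 / qPochInf (s ^ 2) (s ^ 2))) := by
  have hs2 := norm_sq_lt_one hs
  have h : Tendsto (fun m : ℤ => 1 / qPoch (s ^ 2) (s ^ 2) m.toNat) atTop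
      (𝓝 (1 / qPochInf (s ^ 2) (s ^ 2))) :=
    (tendsto_const_nhds.div (tendsto_qPoch (s ^ 2) hs2)
      (qPochInf_ne_zero_of_norm_lt_one hs2 hs2)).comp
      (tendsto_atTop_atTop.mpr fun b => ⟨b, fun a ha => by lia⟩)
  refine h.congr' ?_
  filter_upwards [eventually_ge_atTop 0] with m hm
  rw [qPochRecip, if_pos hm]

theorem exists_norm_qPochRecip_le (hs : ‖s‖ < 1) :
    ∃ C : ℝ, 0 ≤ C ∧ ∀ m : ℤ, ‖qPochRecip s m‖ ≤ C := by
  have h := ((tendsto_qPochRecip hs).comp tendsto_natCast_atTop_atTop).norm.bddAbove_range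
  obtain ⟨C, hC⟩ := h
  have hC' : ∀ n : ℕ, ‖qPochRecip s n‖ ≤ C := fun n => hC ⟨n, rfl⟩
  have h0 : 0 ≤ C := (norm_nonneg _).trans (hC' 0)
  refine ⟨C, h0, fun m => ?_⟩
  rcases lt_or_ge m 0 with hm | hm
  · simpa [qPochRecip_of_neg hm] using h0
  · lift m to ℕ using hm
    exact hC' m

end Recip

section FiniteIdentities

variable {s : ℂ}

theorem summable_of_eq_zero_off_Icc {f : ℤ → ℂ} (a b : ℤ) (h : ∀ j, j < a ∨ b < j → f j = 0) :
    Summable f :=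
  summable_of_ne_finset_zero (s := Finset.Icc a b) fun j hj => h j (by
    rw [Finset.mem_Icc] at hj; lia)

theorem tsum_add_mul_shift {f g : ℤ → ℂ} (hf : Summable f) (hg : Summable g) (c : ℂ) :
    ∑' j, (f j + c * g (j - 1)) = ∑' j, f j + c * ∑' j, g j := by
  have hg' : Summable fun j => g (j - 1) := (Equiv.subRight (1 : ℤ)).summable_iff.mpr hg
  have e : ∑' j, g (j - 1) = ∑' j, g j := (Equiv.subRight (1 : ℤ)).tsum_eq g
  rw [hf.tsum_add (hg'.mul_left c), tsum_mul_left, e]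

/-- The summand of the finite form of the Jacobi triple product. -/
noncomputable def tripleTerm (s z : ℂ) (m n j : ℤ) : ℂ :=
  (-z) ^ j * s ^ (j * (j - 1)) * qPochRecip s (m - j) * qPochRecip s (n + j)

theorem summable_tripleTerm (z : ℂ) (m n : ℤ) : Summable (tripleTerm s z m n) :=
  summable_of_eq_zero_off_Icc (-n) m fun j hj => by
    rcases hj with h | h
    · simp [tripleTerm, qPochRecip_of_neg (show n + j < 0 by lia)]
    · simp [tripleTerm, qPochRecip_of_neg (show m - j < 0 by lia)]

theorem tripleTerm_succ (hs0 : s ≠ 0) (hs : ‖s‖ < 1) {z : ℂ} (hz : z ≠ 0) (m n j : ℤ) :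
    (1 - s ^ (2 * (m + n + 1))) * tripleTerm s z (m + 1) n j =
      tripleTerm s z m n j + (-(z * s ^ (2 * m))) * tripleTerm s z m n (j - 1) := by
  have h1 := one_sub_zpow_mul_qPochRecip hs (m + 1 - j)
  have h2 := one_sub_zpow_mul_qPochRecip hs (n + j)
  have e1 : s ^ (2 * (m + n + 1)) = s ^ (2 * (m + 1 - j)) * s ^ (2 * (n + j)) := by
    rw [← zpow_add₀ hs0]; congr 1; ring
  have e2 : (-z) ^ j = (-z) ^ (j - 1) * (-z) := by
    rw [← zpow_add_one₀ (neg_ne_zero.mpr hz)]; congr 1; ring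
  have e3 : s ^ (2 * m) * s ^ ((j - 1) * (j - 1 - 1)) =
      s ^ (j * (j - 1)) * s ^ (2 * (m + 1 - j)) := by
    rw [← zpow_add₀ hs0, ← zpow_add₀ hs0]; congr 1; ring
  rw [show m + 1 - j - 1 = m - j by ring] at h1
  simp only [tripleTerm]
  rw [e1, show m - (j - 1) = m + 1 - j by ring, show n + (j - 1) = n + j - 1 by ring, e2, ← h1,
    ← h2]
  linear_combination (-z) ^ (j - 1) * (z * qPochRecip s (m + 1 - j) *
    ((1 - s ^ (2 * (n + j))) * qPochRecip s (n + j))) * e3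

theorem tsum_tripleTerm_succ (hs0 : s ≠ 0) (hs : ‖s‖ < 1) {z : ℂ} (hz : z ≠ 0) (m n : ℤ) :
    (1 - s ^ (2 * (m + n + 1))) * ∑' j, tripleTerm s z (m + 1) n j =
      (1 - z * s ^ (2 * m)) * ∑' j, tripleTerm s z m n j := by
  rw [← tsum_mul_left, tsum_congr (tripleTerm_succ hs0 hs hz m n),
    tsum_add_mul_shift (summable_tripleTerm z m n) (summable_tripleTerm z m n)]
  ring

theorem tripleTerm_neg (hs0 : s ≠ 0) (z : ℂ) (m n j : ℤ) :
    tripleTerm s z m n (-j) = tripleTerm s (s ^ 2 / z) n m j := by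
  have e : s ^ (-j * (-j - 1)) = s ^ (j * (j - 1)) * (s ^ 2) ^ j := by
    rw [← zpow_natCast s 2, ← zpow_mul, ← zpow_add₀ hs0]; congr 1; push_cast; ring
  simp only [tripleTerm]
  rw [e, show -(s ^ 2 / z) = s ^ 2 * (-z)⁻¹ by rw [inv_neg]; ring, mul_zpow, inv_zpow, zpow_neg,
    sub_neg_eq_add, ← sub_eq_add_neg]
  ring

theorem tsum_tripleTerm_symm (hs0 : s ≠ 0) (z : ℂ) (m n : ℤ) :
    ∑' j, tripleTerm s z m n j = ∑' j, tripleTerm s (s ^ 2 / z) n m j := by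
  rw [← (Equiv.neg ℤ).tsum_eq]
  exact tsum_congr (tripleTerm_neg hs0 z m n)

theorem tsum_tripleTerm_eq_mul (hs0 : s ≠ 0) (hs : ‖s‖ < 1) {z : ℂ} (hz : z ≠ 0) (m n : ℕ) :
    qPochRecip s n * ∑' j, tripleTerm s z m n j =
      qPoch z (s ^ 2) m * qPochRecip s (m + n) * ∑' j, tripleTerm s z 0 n j := by
  induction m with
  | zero => simp [qPoch]
  | succ m ih =>
    have h := tsum_tripleTerm_succ hs0 hs hz m n
    have h0 := one_sub_zpow_ne_zero hs (m + n)
    have h1 := one_sub_zpow_mul_qPochRecip hs (m + n + 1)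
    rw [add_sub_cancel_right] at h1
    have e : s ^ (2 * (m : ℤ)) = (s ^ 2) ^ m := by rw [← pow_mul]; exact_mod_cast rfl
    push_cast at h0 ⊢
    rw [e] at h
    rw [show (m : ℤ) + 1 + n = m + n + 1 by ring, qPoch_succ]
    apply mul_left_cancel₀ h0
    rw [← h1] at ih
    linear_combination qPochRecip s n * h + (1 - z * (s ^ 2) ^ m) * ih

theorem qPochRecip_ne_zero (hs : ‖s‖ < 1) (n : ℕ) : qPochRecip s n ≠ 0 := by
  rw [qPochRecip_natCast]
  exact one_div_ne_zero (qPoch_ne_zero (norm_sq_lt_one hs) (norm_sq_lt_one hs) n)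

/-- The finite form of the Jacobi triple product identity. -/
theorem tsum_tripleTerm (hs0 : s ≠ 0) (hs : ‖s‖ < 1) {z : ℂ} (hz : z ≠ 0) (m n : ℕ) :
    ∑' j, tripleTerm s z m n j =
      qPoch z (s ^ 2) m * qPoch (s ^ 2 / z) (s ^ 2) n * qPochRecip s (m + n) := by
  have h00 : ∑' j, tripleTerm s (s ^ 2 / z) 0 0 j = 1 := by
    rw [tsum_eq_single 0]
    · simp [tripleTerm, qPochRecip_zero]
    · intro j hj
      rcases lt_or_gt_of_ne hj with h | h
      · simp [tripleTerm, qPochRecip_of_neg h]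
      · simp [tripleTerm, qPochRecip_of_neg (show -j < 0 by lia)]
  have h1 := tsum_tripleTerm_eq_mul hs0 hs hz m n
  have h2 := tsum_tripleTerm_eq_mul hs0 hs (div_ne_zero (pow_ne_zero 2 hs0) hz) n 0
  rw [tsum_tripleTerm_symm hs0 z 0 n] at h1
  simp only [Nat.cast_zero, qPochRecip_zero, h00, add_zero, one_mul, mul_one] at h2
  rw [h2] at h1
  apply mul_left_cancel₀ (qPochRecip_ne_zero hs n)
  rw [h1]
  ring

/-- The summand of the `q`-Chu-Vandermonde sum behind Bailey's lemma. -/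
noncomputable def vandermondeTerm (s : ℂ) (m a i : ℤ) : ℂ :=
  s ^ (2 * (i * (i + a))) * qPochRecip s (m - i) * qPochRecip s i * qPochRecip s (i + a)

theorem vandermondeTerm_eq_zero {m a i : ℤ} (hi : i < 0 ∨ m < i) :
    vandermondeTerm s m a i = 0 := by
  rcases hi with h | h
  · simp [vandermondeTerm, qPochRecip_of_neg h]
  · simp [vandermondeTerm, qPochRecip_of_neg (show m - i < 0 by lia)]

theorem summable_vandermondeTerm (m a : ℤ) : Summable (vandermondeTerm s m a) :=
  summable_of_eq_zero_off_Icc 0 m fun _ => vandermondeTerm_eq_zero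

theorem vandermondeTerm_succ (hs0 : s ≠ 0) (hs : ‖s‖ < 1) (m a i : ℤ) :
    (1 - s ^ (2 * (m + 1))) * vandermondeTerm s (m + 1) a i =
      vandermondeTerm s m a i + s ^ (2 * (m + 1 + a)) * vandermondeTerm s m (a + 1) (i - 1) := by
  have h1 := one_sub_zpow_mul_qPochRecip hs (m + 1 - i)
  have h2 := one_sub_zpow_mul_qPochRecip hs i
  have e1 : s ^ (2 * (m + 1)) = s ^ (2 * (m + 1 - i)) * s ^ (2 * i) := by
    rw [← zpow_add₀ hs0]; congr 1; ring
  have e2 : s ^ (2 * (m + 1 + a)) * s ^ (2 * ((i - 1) * (i + a))) =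
      s ^ (2 * (i * (i + a))) * s ^ (2 * (m + 1 - i)) := by
    rw [← zpow_add₀ hs0, ← zpow_add₀ hs0]; congr 1; ring
  rw [show m + 1 - i - 1 = m - i by ring] at h1
  simp only [vandermondeTerm]
  rw [e1, show m - (i - 1) = m + 1 - i by ring, show i - 1 + (a + 1) = i + a by ring, ← h1, ← h2]
  linear_combination -(qPochRecip s (m + 1 - i) * ((1 - s ^ (2 * i)) * qPochRecip s i) *
    qPochRecip s (i + a)) * e2

theorem tsum_vandermondeTerm (hs0 : s ≠ 0) (hs : ‖s‖ < 1) (m a : ℤ) :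
    ∑' i, vandermondeTerm s m a i = qPochRecip s m * qPochRecip s (m + a) := by
  rcases lt_or_ge m 0 with hm | hm
  · rw [qPochRecip_of_neg hm, zero_mul]
    exact (tsum_congr fun i => vandermondeTerm_eq_zero (by lia)).trans tsum_zero
  lift m to ℕ using hm
  induction m generalizing a with
  | zero =>
    rw [tsum_eq_single 0 fun i hi => vandermondeTerm_eq_zero (by push_cast; lia)]
    simp [vandermondeTerm, qPochRecip_zero]
  | succ m ih =>
    have h0 := one_sub_zpow_ne_zero hs m
    have h1 := one_sub_zpow_mul_qPochRecip hs (m + 1)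
    have h2 := one_sub_zpow_mul_qPochRecip hs (m + 1 + a)
    rw [add_sub_cancel_right] at h1
    rw [show (m : ℤ) + 1 + a - 1 = m + a by ring] at h2
    push_cast
    apply mul_left_cancel₀ h0
    rw [← tsum_mul_left, tsum_congr (vandermondeTerm_succ hs0 hs m a),
      tsum_add_mul_shift (summable_vandermondeTerm _ _) (summable_vandermondeTerm _ _), ih, ih,
      show (m : ℤ) + (a + 1) = m + 1 + a by ring]
    linear_combination -qPochRecip s m * h2 - qPochRecip s (m + 1 + a) * h1

/-- The terms of the Rogers-Szegő polynomial of degree `n`, divided by `(s²; s²)_n`. -/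
noncomputable def rogersSzegoTerm (s z : ℂ) (n i : ℤ) : ℂ :=
  z ^ i * qPochRecip s i * qPochRecip s (n - i)

theorem rogersSzegoTerm_eq_zero {z : ℂ} {n i : ℤ} (hi : i < 0 ∨ n < i) :
    rogersSzegoTerm s z n i = 0 := by
  rcases hi with h | h
  · simp [rogersSzegoTerm, qPochRecip_of_neg h]
  · simp [rogersSzegoTerm, qPochRecip_of_neg (show n - i < 0 by lia)]

theorem summable_rogersSzegoTerm (z : ℂ) (n : ℤ) : Summable (rogersSzegoTerm s z n) :=
  summable_of_eq_zero_off_Icc 0 n fun _ => rogersSzegoTerm_eq_zero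

theorem tsum_rogersSzegoTerm_of_neg (z : ℂ) {n : ℤ} (hn : n < 0) :
    ∑' i, rogersSzegoTerm s z n i = 0 :=
  (tsum_congr fun i => rogersSzegoTerm_eq_zero (by lia)).trans tsum_zero

theorem tsum_rogersSzegoTerm_zero (z : ℂ) : ∑' i, rogersSzegoTerm s z 0 i = 1 := by
  rw [tsum_eq_single 0 fun i hi => rogersSzegoTerm_eq_zero (by lia)]
  simp [rogersSzegoTerm, qPochRecip_zero]

theorem tsum_rogersSzegoTerm_succ (hs0 : s ≠ 0) (hs : ‖s‖ < 1) {z : ℂ} (hz : z ≠ 0) (n : ℤ) :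
    (1 - s ^ (2 * (n + 1))) * ∑' i, rogersSzegoTerm s z (n + 1) i =
      (1 + z) * ∑' i, rogersSzegoTerm s z n i - z * ∑' i, rogersSzegoTerm s z (n - 1) i := by
  have hsum := summable_rogersSzegoTerm (s := s) z
  have key (i : ℤ) : (1 - s ^ (2 * (n + 1))) * rogersSzegoTerm s z (n + 1) i =
      rogersSzegoTerm s z n i +
        z * (rogersSzegoTerm s z n (i - 1) - rogersSzegoTerm s z (n - 1) (i - 1)) := by
    have h1 := one_sub_zpow_mul_qPochRecip hs (n + 1 - i)
    have h2 := one_sub_zpow_mul_qPochRecip hs i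
    have e1 : s ^ (2 * (n + 1)) = s ^ (2 * (n + 1 - i)) * s ^ (2 * i) := by
      rw [← zpow_add₀ hs0]; congr 1; ring
    have e2 : z ^ i = z ^ (i - 1) * z := by
      rw [← zpow_add_one₀ hz]; congr 1; ring
    rw [show n + 1 - i - 1 = n - i by ring] at h1
    simp only [rogersSzegoTerm]
    rw [e1, e2, show n - (i - 1) = n + 1 - i by ring, show n - 1 - (i - 1) = n - i by ring, ← h1,
      ← h2]
    ring
  rw [← tsum_mul_left, tsum_congr key,
    tsum_add_mul_shift (hsum n) ((hsum n).sub (hsum (n - 1))) z,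
    (hsum n).tsum_sub (hsum (n - 1))]
  ring

theorem tsum_rogersSzegoTerm_neg_one (hs0 : s ≠ 0) (hs : ‖s‖ < 1) (m : ℤ) :
    ∑' i, rogersSzegoTerm s (-1) (2 * m) i = qPochRecip (s ^ 2) m ∧
      ∑' i, rogersSzegoTerm s (-1) (2 * m + 1) i = 0 := by
  have hs' := norm_sq_lt_one hs
  have hrec := tsum_rogersSzegoTerm_succ hs0 hs (neg_ne_zero.mpr one_ne_zero)
  rcases lt_or_ge m 0 with hm | hm
  · rw [tsum_rogersSzegoTerm_of_neg _ (by lia), tsum_rogersSzegoTerm_of_neg _ (by lia),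
      qPochRecip_of_neg hm]
    exact ⟨rfl, rfl⟩
  lift m to ℕ using hm
  have hodd {n : ℕ} (h : ∑' i, rogersSzegoTerm s (-1) (2 * n - 1) i = 0) :
      ∑' i, rogersSzegoTerm s (-1) (2 * n + 1) i = 0 := by
    have h1 := hrec (2 * n)
    have h0 := one_sub_zpow_ne_zero hs (2 * n)
    push_cast at h0
    rw [h] at h1
    simpa [h0] using h1
  induction m with
  | zero =>
    refine ⟨by simp [tsum_rogersSzegoTerm_zero, qPochRecip_zero], hodd ?_⟩
    exact tsum_rogersSzegoTerm_of_neg _ (by norm_num)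
  | succ m ih =>
    have h2 : ∑' i, rogersSzegoTerm s (-1) (2 * (m + 1 : ℕ) - 1) i = 0 := by
      rw [← ih.2]; congr! 3; push_cast; ring
    refine ⟨?_, hodd h2⟩
    have h3 := hrec (2 * m + 1)
    have h0 := one_sub_zpow_ne_zero hs' m
    have h1 := one_sub_zpow_mul_qPochRecip hs' (m + 1)
    have e : s ^ (2 * ((2 : ℤ) * m + 1 + 1)) = (s ^ 2) ^ (2 * ((m : ℤ) + 1)) := by
      rw [← zpow_natCast s 2, ← zpow_mul]; congr 1
    rw [add_sub_cancel_right] at h1 h3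
    rw [ih.1, ← h1, e, show (2 : ℤ) * m + 1 + 1 = 2 * (m + 1) by ring] at h3
    push_cast
    apply mul_left_cancel₀ h0
    rw [h3]
    ring

theorem tsum_rogersSzegoTerm_sq (hs0 : s ≠ 0) (hs : ‖s‖ < 1) (n : ℤ) :
    ∑' i, rogersSzegoTerm (s ^ 2) (s ^ 2) n i = qPochRecip s n := by
  have hs' := norm_sq_lt_one hs
  have hrec := tsum_rogersSzegoTerm_succ (pow_ne_zero 2 hs0) hs' (pow_ne_zero 2 hs0)
  rcases lt_or_ge n 0 with hn | hn
  · rw [tsum_rogersSzegoTerm_of_neg _ hn, qPochRecip_of_neg hn]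
  lift n to ℕ using hn
  suffices h : ∑' i, rogersSzegoTerm (s ^ 2) (s ^ 2) ((n : ℤ) - 1) i = qPochRecip s (n - 1) ∧
      ∑' i, rogersSzegoTerm (s ^ 2) (s ^ 2) n i = qPochRecip s n from h.2
  induction n with
  | zero =>
    rw [tsum_rogersSzegoTerm_of_neg _ (by norm_num), qPochRecip_of_neg (by norm_num)]
    exact ⟨rfl, by simp [tsum_rogersSzegoTerm_zero, qPochRecip_zero]⟩
  | succ n ih =>
    have h3 := hrec n
    have h0 := one_sub_zpow_ne_zero hs' n
    have h1 := one_sub_zpow_mul_qPochRecip hs (n + 1)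
    have h2 := one_sub_zpow_mul_qPochRecip hs n
    rw [add_sub_cancel_right] at h1
    have e1 : (s ^ 2) ^ (2 * ((n : ℤ) + 1)) = s ^ (2 * ((n : ℤ) + 1)) * s ^ (2 * ((n : ℤ) + 1)) := by
      rw [← zpow_natCast s 2, ← zpow_mul, ← zpow_add₀ hs0]; congr 1; push_cast; ring
    have e2 : s ^ (2 * ((n : ℤ) + 1)) = s ^ (2 * (n : ℤ)) * s ^ 2 := by
      rw [← zpow_natCast s 2, ← zpow_add₀ hs0]; congr 1
    rw [ih.1, ih.2] at h3
    push_cast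
    rw [add_sub_cancel_right]
    refine ⟨ih.2, mul_left_cancel₀ h0 ?_⟩
    rw [h3, ← h2, e1, ← h1, e2]
    ring

end FiniteIdentities

section Limits

variable {s : ℂ}

/-- Bailey's lemma for finite sums with parameter `a = 1`. -/
theorem tsum_bailey (hs0 : s ≠ 0) (hs : ‖s‖ < 1) (c : ℤ → ℂ) (n : ℤ) :
    ∑' k : ℤ, s ^ (2 * k ^ 2) * qPochRecip s (n - k) *
        ∑' j : ℤ, c j * qPochRecip s (k - j) * qPochRecip s (k + j) =
      ∑' j : ℤ, s ^ (2 * j ^ 2) * c j * qPochRecip s (n - j) * qPochRecip s (n + j) := by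
  let f (k j : ℤ) : ℂ := s ^ (2 * k ^ 2) * qPochRecip s (n - k) *
    (c j * qPochRecip s (k - j) * qPochRecip s (k + j))
  have hf : Summable (Function.uncurry f) := by
    refine summable_of_ne_finset_zero (s := Finset.Icc 0 n ×ˢ Finset.Icc (-n) n) ?_
    rintro ⟨k, j⟩ h
    rw [Finset.mem_product, Finset.mem_Icc, Finset.mem_Icc] at h
    obtain h | h | h : n - k < 0 ∨ k - j < 0 ∨ k + j < 0 := by
      lia
    all_goals simp [f, Function.uncurry, qPochRecip_of_neg h]
  calc
    _ = ∑' (k : ℤ) (j : ℤ), f k j := tsum_congr fun k => by rw [← tsum_mul_left]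
    _ = ∑' (j : ℤ) (k : ℤ), f k j := hf.tsum_comm.symm
    _ = _ := tsum_congr fun j => by
      have h := tsum_vandermondeTerm hs0 hs (n - j) (2 * j)
      rw [show n - j + 2 * j = n + j by ring] at h
      rw [← (Equiv.addRight j).tsum_eq, mul_assoc, ← h, ← tsum_mul_left]
      refine tsum_congr fun i => ?_
      have e : s ^ (2 * (i + j) ^ 2) = s ^ (2 * j ^ 2) * s ^ (2 * (i * (i + 2 * j))) := by
        rw [← zpow_add₀ hs0]; congr 1; ring
      simp only [f, vandermondeTerm, Equiv.coe_addRight]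
      rw [e, show n - (i + j) = n - j - i by ring, add_sub_cancel_right,
        show i + j + j = i + 2 * j by ring]
      ring

/-- The finite form of the first Rogers-Ramanujan identity. -/
theorem tsum_rogersRamanujan_finite (hs0 : s ≠ 0) (hs : ‖s‖ < 1) (n : ℤ) :
    ∑' k : ℤ, s ^ (2 * k ^ 2) * qPochRecip s (n - k) * qPochRecip s k =
      ∑' j : ℤ, (-1) ^ j * s ^ (5 * j ^ 2 - j) * (qPochRecip s (n - j) * qPochRecip s (n + j)) := by
  have hunit (k : ℤ) : ∑' j : ℤ, (-1) ^ j * s ^ (j * (j - 1)) * qPochRecip s (k - j) *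
      qPochRecip s (k + j) = if k = 0 then 1 else 0 := by
    rcases lt_or_ge k 0 with hk | hk
    · rw [if_neg hk.ne]
      refine (tsum_congr fun j => ?_).trans tsum_zero
      obtain h | h : k - j < 0 ∨ k + j < 0 := by lia
      all_goals simp [qPochRecip_of_neg h]
    · lift k to ℕ using hk
      refine (tsum_tripleTerm hs0 hs one_ne_zero k k).trans ?_
      rcases k with _ | k
      · simp [qPoch, qPochRecip_zero]
      · rw [if_neg (by exact_mod_cast k.succ_ne_zero), qPoch, Finset.prod_range_succ']
        simp
  have hbase (k : ℤ) : ∑' j : ℤ, s ^ (2 * j ^ 2) * ((-1) ^ j * s ^ (j * (j - 1))) *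
      qPochRecip s (k - j) * qPochRecip s (k + j) = qPochRecip s k := by
    rw [← tsum_bailey hs0 hs, tsum_eq_single 0]
    · rw [hunit, if_pos rfl]
      simp
    · intro i hi
      rw [hunit, if_neg hi, mul_zero]
  have h := tsum_bailey hs0 hs (fun j => s ^ (2 * j ^ 2) * ((-1) ^ j * s ^ (j * (j - 1)))) n
  simp only [hbase] at h
  rw [h]
  refine tsum_congr fun j => ?_
  have e : s ^ (5 * j ^ 2 - j) = s ^ (2 * j ^ 2) * s ^ (2 * j ^ 2) * s ^ (j * (j - 1)) := by
    rw [← zpow_add₀ hs0, ← zpow_add₀ hs0]; congr 1; ring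
  rw [e]
  ring

theorem norm_zpow_le_pow (hs0 : s ≠ 0) (hs : ‖s‖ < 1) {e : ℤ} {n : ℕ} (h : (n : ℤ) ≤ e) :
    ‖s ^ e‖ ≤ ‖s‖ ^ n := by
  rw [norm_zpow, ← zpow_natCast]
  exact zpow_le_zpow_right_of_le_one₀ (norm_pos_iff.mpr hs0) hs.le h

theorem summable_pow_natAbs {x : ℝ} (h0 : 0 ≤ x) (h1 : x < 1) :
    Summable fun j : ℤ => x ^ j.natAbs := by
  have h := summable_geometric_of_lt_one h0 h1
  exact Summable.of_nat_of_neg (by simpa using h) (by simpa using h)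

theorem natAbs_le_sq (j : ℤ) : (j.natAbs : ℤ) ≤ j ^ 2 := by
  rw [← Int.natAbs_sq]
  exact_mod_cast Nat.le_self_pow two_ne_zero _

theorem tendsto_tsum_mul_of_bounded {c : ℤ → ℂ} (hc : Summable fun j => ‖c j‖) {w : ℕ → ℤ → ℂ}
    {C : ℝ} (hw : ∀ n j, ‖w n j‖ ≤ C) {l : ℂ} (hl : ∀ j, Tendsto (w · j) atTop (𝓝 l)) :
    Tendsto (fun n => ∑' j, c j * w n j) atTop (𝓝 ((∑' j, c j) * l)) := by
  rw [← tsum_mul_right]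
  refine tendsto_tsum_of_dominated_convergence (hc.mul_right C)
    (fun j => (hl j).const_mul (c j)) (Eventually.of_forall fun n j => ?_)
  rw [norm_mul]
  exact mul_le_mul_of_nonneg_left (hw n j) (norm_nonneg _)

theorem tendsto_qPochRecip_natCast_add (hs : ‖s‖ < 1) (j : ℤ) :
    Tendsto (fun n : ℕ => qPochRecip s (n + j)) atTop (𝓝 (1 / qPochInf (s ^ 2) (s ^ 2))) :=
  (tendsto_qPochRecip hs).comp (tendsto_atTop_add_const_right _ j tendsto_natCast_atTop_atTop)

theorem tendsto_tsum_mul_qPochRecip (hs : ‖s‖ < 1) {c : ℤ → ℂ} (hc : Summable fun j => ‖c j‖) :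
    Tendsto (fun n : ℕ => ∑' j : ℤ, c j * qPochRecip s (n - j)) atTop
      (𝓝 ((∑' j, c j) * (1 / qPochInf (s ^ 2) (s ^ 2)))) := by
  obtain ⟨C, -, hC⟩ := exists_norm_qPochRecip_le hs
  exact tendsto_tsum_mul_of_bounded hc (fun n j => hC _)
    fun j => tendsto_qPochRecip_natCast_add hs (-j)

theorem tendsto_tsum_mul_qPochRecip_mul (hs : ‖s‖ < 1) {c : ℤ → ℂ}
    (hc : Summable fun j => ‖c j‖) :
    Tendsto (fun n : ℕ => ∑' j : ℤ, c j * (qPochRecip s (n - j) * qPochRecip s (n + j))) atTop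
      (𝓝 ((∑' j, c j) * (1 / qPochInf (s ^ 2) (s ^ 2) * (1 / qPochInf (s ^ 2) (s ^ 2))))) := by
  obtain ⟨C, hC0, hC⟩ := exists_norm_qPochRecip_le hs
  refine tendsto_tsum_mul_of_bounded (C := C * C) hc (fun n j => ?_) fun j =>
    (tendsto_qPochRecip_natCast_add hs (-j)).mul (tendsto_qPochRecip_natCast_add hs j)
  rw [norm_mul]
  exact mul_le_mul (hC _) (hC _) (norm_nonneg _) hC0

theorem qPochInf_sq_ne_zero (hs : ‖s‖ < 1) : qPochInf (s ^ 2) (s ^ 2) ≠ 0 :=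
  qPochInf_ne_zero_of_norm_lt_one (norm_sq_lt_one hs) (norm_sq_lt_one hs)

/-- The Jacobi triple product identity. -/
theorem tsum_jacobi_triple (hs0 : s ≠ 0) (hs : ‖s‖ < 1) {z : ℂ} (hz : z ≠ 0)
    (hc : Summable fun j : ℤ => ‖(-z) ^ j * s ^ (j * (j - 1))‖) :
    ∑' j : ℤ, (-z) ^ j * s ^ (j * (j - 1)) =
      qPochInf z (s ^ 2) * qPochInf (s ^ 2 / z) (s ^ 2) * qPochInf (s ^ 2) (s ^ 2) := by
  have hs2 := norm_sq_lt_one hs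
  have hP := qPochInf_sq_ne_zero hs
  have h1 := tendsto_tsum_mul_qPochRecip_mul hs hc
  have h2 : Tendsto (fun n : ℕ => qPoch z (s ^ 2) n * qPoch (s ^ 2 / z) (s ^ 2) n *
      qPochRecip s (n + n)) atTop (𝓝 (qPochInf z (s ^ 2) * qPochInf (s ^ 2 / z) (s ^ 2) *
        (1 / qPochInf (s ^ 2) (s ^ 2)))) :=
    ((tendsto_qPoch z hs2).mul (tendsto_qPoch (s ^ 2 / z) hs2)).mul
      ((tendsto_qPochRecip hs).comp (tendsto_natCast_atTop_atTop.atTop_add_atTop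
        tendsto_natCast_atTop_atTop))
  have h := tendsto_nhds_unique (h1.congr fun n => ?_) h2
  · field_simp at h
    linear_combination h
  · rw [← tsum_tripleTerm hs0 hs hz n n]
    exact tsum_congr fun j => by rw [tripleTerm]; ring

/-- Euler's expansion of `(-s^{2m+2}; s²)_∞`. -/
theorem tsum_euler (hs0 : s ≠ 0) (hs : ‖s‖ < 1) (m : ℕ) :
    ∑' k : ℤ, s ^ (k ^ 2 + k + 2 * m * k) * qPochRecip s k =
      qPochInf (-s ^ 2 * (s ^ 2) ^ m) (s ^ 2) := by
  have hP := qPochInf_sq_ne_zero hs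
  obtain ⟨C, hC0, hC⟩ := exists_norm_qPochRecip_le hs
  have hz : -s ^ 2 * (s ^ 2) ^ m ≠ 0 :=
    mul_ne_zero (neg_ne_zero.mpr (pow_ne_zero 2 hs0)) (pow_ne_zero _ (pow_ne_zero 2 hs0))
  have hc : Summable fun k : ℤ => ‖s ^ (k ^ 2 + k + 2 * m * k) * qPochRecip s k‖ := by
    refine Summable.of_nonneg_of_le (fun _ => norm_nonneg _) (fun k => ?_)
      ((summable_pow_natAbs (norm_nonneg s) hs).mul_right C)
    rcases lt_or_ge k 0 with hk | hk
    · rw [qPochRecip_of_neg hk, mul_zero, norm_zero]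
      positivity
    · rw [norm_mul]
      have : 0 ≤ (m : ℤ) * k := by positivity
      exact mul_le_mul (norm_zpow_le_pow hs0 hs (by linarith [natAbs_le_sq k])) (hC k)
        (norm_nonneg _) (by positivity)
  have h1 := tendsto_tsum_mul_qPochRecip hs hc
  have h2 := (tendsto_qPoch (-s ^ 2 * (s ^ 2) ^ m) (norm_sq_lt_one hs)).mul
    (tendsto_qPochRecip_natCast_add hs 0)
  have h := tendsto_nhds_unique (h1.congr fun n => ?_) h2
  · exact mul_right_cancel₀ (one_div_ne_zero hP) h
  · have ht := tsum_tripleTerm hs0 hs hz n 0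
    simp only [qPoch, Finset.prod_range_zero, mul_one, Nat.cast_zero] at ht
    rw [qPoch, ← ht]
    refine tsum_congr fun k => ?_
    have e : s ^ (k ^ 2 + k + 2 * m * k) =
        (-(-s ^ 2 * (s ^ 2) ^ m)) ^ k * s ^ (k * (k - 1)) := by
      rw [neg_mul, neg_neg, ← pow_succ', ← pow_mul, ← zpow_natCast, ← zpow_mul, ← zpow_add₀ hs0]
      congr 1; push_cast; ring
    rw [tripleTerm, e, zero_add]
    ring

/-- The first Rogers-Ramanujan identity, before simplifying the product side. -/
theorem tsum_rogersRamanujan (hs0 : s ≠ 0) (hs : ‖s‖ < 1) :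
    (∑' k : ℤ, s ^ (2 * k ^ 2) * qPochRecip s k) * qPochInf (s ^ 2) (s ^ 2) =
      qPochInf (s ^ 4) (s ^ 10) * qPochInf (s ^ 6) (s ^ 10) * qPochInf (s ^ 10) (s ^ 10) := by
  have hP := qPochInf_sq_ne_zero hs
  obtain ⟨C, hC0, hC⟩ := exists_norm_qPochRecip_le hs
  have hgeom := summable_pow_natAbs (norm_nonneg s) hs
  have hc1 : Summable fun k : ℤ => ‖s ^ (2 * k ^ 2) * qPochRecip s k‖ := by
    refine Summable.of_nonneg_of_le (fun _ => norm_nonneg _) (fun k => ?_) (hgeom.mul_right C)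
    rw [norm_mul]
    exact mul_le_mul (norm_zpow_le_pow hs0 hs (by linarith [natAbs_le_sq k, sq_nonneg k])) (hC k)
      (norm_nonneg _) (by positivity)
  have hc2 : Summable fun j : ℤ => ‖(-1) ^ j * s ^ (5 * j ^ 2 - j)‖ := by
    refine Summable.of_nonneg_of_le (fun _ => norm_nonneg _) (fun j => ?_) hgeom
    rw [norm_mul, norm_zpow, norm_neg, norm_one, one_zpow, one_mul]
    have h1 : j ≤ (j.natAbs : ℤ) := Int.le_natAbs
    exact norm_zpow_le_pow hs0 hs (by linarith [natAbs_le_sq j, sq_nonneg j])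
  have h := tendsto_nhds_unique ((tendsto_tsum_mul_qPochRecip hs hc1).congr fun n => ?_)
    (tendsto_tsum_mul_qPochRecip_mul hs hc2)
  · have hterm (j : ℤ) : (-s ^ 4) ^ j * (s ^ 5) ^ (j * (j - 1)) = (-1) ^ j * s ^ (5 * j ^ 2 - j) := by
      rw [neg_eq_neg_one_mul, mul_zpow, mul_assoc, ← zpow_natCast s 4, ← zpow_natCast s 5,
        ← zpow_mul, ← zpow_mul, ← zpow_add₀ hs0]
      congr 2; push_cast; ring
    have hs5 : ‖s ^ 5‖ < 1 := by
      rw [norm_pow]; exact pow_lt_one₀ (norm_nonneg s) hs (by norm_num)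
    have hj := tsum_jacobi_triple (pow_ne_zero 5 hs0) hs5 (pow_ne_zero 4 hs0)
      (by simpa only [hterm] using hc2)
    rw [tsum_congr hterm, ← pow_mul, show s ^ (5 * 2) / s ^ 4 = s ^ 6 by field_simp] at hj
    rw [← hj]
    field_simp at h
    exact h
  · rw [← tsum_rogersRamanujan_finite hs0 hs]
    exact tsum_congr fun k => by ring

end Limits

section DoubleSums

variable {s : ℂ}

/-- The summand of the double series `∑ u^{(i+j)²} z^j / ((s²; s²)_i (s²; s²)_j)`. -/
noncomputable def doubleTerm (s u z : ℂ) (p : ℤ × ℤ) : ℂ :=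
  u ^ ((p.1 + p.2) ^ 2) * z ^ p.2 * qPochRecip s p.1 * qPochRecip s p.2

theorem doubleTerm_eq_zero {u z : ℂ} {p : ℤ × ℤ} (hp : p.1 < 0 ∨ p.2 < 0) :
    doubleTerm s u z p = 0 := by
  rcases hp with h | h <;> simp [doubleTerm, qPochRecip_of_neg h]

theorem summable_doubleTerm (hs : ‖s‖ < 1) {u z : ℂ} (hu0 : u ≠ 0) (hu : ‖u‖ < 1)
    (hz : ‖z‖ ≤ 1) : Summable (doubleTerm s u z) := by
  obtain ⟨C, hC0, hC⟩ := exists_norm_qPochRecip_le hs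
  have hg := summable_pow_natAbs (norm_nonneg u) hu
  have hg2 := (hg.mul_of_nonneg hg (fun _ => by positivity) fun _ => by positivity).mul_right
    (C * C)
  refine Summable.of_norm_bounded hg2 ?_
  rintro ⟨i, j⟩
  by_cases hij : i < 0 ∨ j < 0
  · rw [doubleTerm_eq_zero hij, norm_zero]
    positivity
  · push Not at hij
    obtain ⟨hi, hj⟩ := hij
    have h1 : ‖u ^ ((i + j) ^ 2)‖ ≤ ‖u‖ ^ i.natAbs * ‖u‖ ^ j.natAbs := by
      rw [← pow_add]
      refine norm_zpow_le_pow hu0 hu ?_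
      rw [show i.natAbs + j.natAbs = (i + j).natAbs by lia]
      exact natAbs_le_sq (i + j)
    have h2 : ‖z ^ j‖ ≤ 1 := by
      lift j to ℕ using hj
      rw [zpow_natCast, norm_pow]
      exact pow_le_one₀ (norm_nonneg z) hz
    simp only [doubleTerm, norm_mul]
    calc
      _ ≤ ‖u‖ ^ i.natAbs * ‖u‖ ^ j.natAbs * 1 * C * C := by gcongr <;> apply hC
      _ = _ := by ring

theorem tsum_doubleTerm (hs : ‖s‖ < 1) {u z : ℂ} (hu0 : u ≠ 0) (hu : ‖u‖ < 1) (hz : ‖z‖ ≤ 1) :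
    ∑' p, doubleTerm s u z p = ∑' n : ℤ, u ^ (n ^ 2) * ∑' j, rogersSzegoTerm s z n j := by
  let e : ℤ × ℤ ≃ ℤ × ℤ :=
    { toFun := fun p => (p.1 - p.2, p.2)
      invFun := fun p => (p.1 + p.2, p.2)
      left_inv := fun p => by simp
      right_inv := fun p => by simp }
  have he : Summable fun p => doubleTerm s u z (e p) :=
    (summable_doubleTerm hs hu0 hu hz).comp_injective e.injective
  rw [← e.tsum_eq, he.tsum_prod]
  refine tsum_congr fun n => ?_
  rw [← tsum_mul_left]
  refine tsum_congr fun j => ?_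
  simp only [e, Equiv.coe_fn_mk, doubleTerm, rogersSzegoTerm, sub_add_cancel]
  ring

theorem qPochInf_mul_qPochRecip_sq (hs0 : s ≠ 0) (hs : ‖s‖ < 1) (m : ℤ) :
    qPochInf (-s ^ 2) (s ^ 2) * qPochRecip (s ^ 2) m =
      qPochRecip s m * ∑' k : ℤ, s ^ (k ^ 2 + k + 2 * m * k) * qPochRecip s k := by
  rcases lt_or_ge m 0 with hm | hm
  · rw [qPochRecip_of_neg hm, qPochRecip_of_neg hm, mul_zero, zero_mul]
  lift m to ℕ using hm
  have hs2 := norm_sq_lt_one hs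
  have h1 := qPoch_ne_zero hs2 hs2 m
  have h2 : qPoch (-s ^ 2) (s ^ 2) m ≠ 0 := qPoch_ne_zero (by rwa [norm_neg]) hs2 m
  rw [tsum_euler hs0 hs, qPochInf_eq_qPoch_mul (-s ^ 2) hs2 m, qPochRecip_natCast,
    qPochRecip_natCast, qPoch_sq_sq]
  field_simp

/-- Rogers' transformation relating the bases `(s²)²` and `s`. -/
theorem qPochInf_mul_tsum_eq_tsum (hs0 : s ≠ 0) (hs : ‖s‖ < 1) :
    qPochInf (-s ^ 2) (s ^ 2) * ∑' m : ℤ, s ^ (m ^ 2) * qPochRecip (s ^ 2) m =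
      ∑' n : ℤ, s ^ (n ^ 2) * ∑' j, rogersSzegoTerm s s n j := by
  rw [← tsum_doubleTerm hs hs0 hs hs.le, (summable_doubleTerm hs hs0 hs hs.le).tsum_prod,
    ← tsum_mul_left]
  refine tsum_congr fun m => ?_
  rw [mul_left_comm, qPochInf_mul_qPochRecip_sq hs0 hs, ← mul_assoc, ← tsum_mul_left]
  refine tsum_congr fun k => ?_
  have e : s ^ ((m + k) ^ 2) * s ^ k = s ^ (m ^ 2) * s ^ (k ^ 2 + k + 2 * m * k) := by
    rw [← zpow_add₀ hs0, ← zpow_add₀ hs0]; congr 1; ring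
  rw [doubleTerm]
  linear_combination -(qPochRecip s m * qPochRecip s k) * e

theorem tsum_doubleTerm_neg_one (hs0 : s ≠ 0) (hs : ‖s‖ < 1) :
    ∑' p, doubleTerm (s ^ 4) s (-1) p = ∑' m : ℤ, (s ^ 4) ^ (m ^ 2) * qPochRecip ((s ^ 4) ^ 2) m := by
  have hs4 : ‖s ^ 4‖ < 1 := by
    rw [norm_pow]; exact pow_lt_one₀ (norm_nonneg s) hs (by norm_num)
  have hH := tsum_rogersSzegoTerm_neg_one (pow_ne_zero 4 hs0) hs4
  have hinj : Function.Injective fun m : ℤ => 2 * m := fun a b h => by simpa using h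
  rw [tsum_doubleTerm hs4 hs0 hs (by simp), ← hinj.tsum_eq]
  · refine tsum_congr fun m => ?_
    rw [(hH m).1, ← zpow_natCast s 4, ← zpow_mul]
    congr 2; push_cast; ring
  · intro n hn
    obtain ⟨m, rfl | rfl⟩ := Int.even_or_odd' n
    · exact ⟨m, rfl⟩
    · rw [Function.mem_support, (hH m).2, mul_zero] at hn
      exact absurd rfl hn

end DoubleSums

theorem stmt_6 (q : ℂ) (hq : ‖q‖ < 1) :
    (∑' p : ℕ × ℕ,
        (-1 : ℂ) ^ p.2 * q ^ (p.1 ^ 2 + 2 * p.1 * p.2 + p.2 ^ 2) /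
          (qPoch (q ^ 8) (q ^ 8) p.1 * qPoch (q ^ 8) (q ^ 8) p.2))
      = 1 / (qPochInf (-(q ^ 8)) (q ^ 8) * qPochInf (q ^ 4) (q ^ 20) *
          qPochInf (q ^ 16) (q ^ 20)) := by
  rcases eq_or_ne q 0 with rfl | hq0
  · rw [tsum_eq_single (0, 0)]
    · simp [qPoch, qPochInf]
    · rintro ⟨i, j⟩ hij
      have : i ^ 2 + 2 * i * j + j ^ 2 ≠ 0 := by
        rw [show i ^ 2 + 2 * i * j + j ^ 2 = (i + j) ^ 2 by ring]
        refine pow_ne_zero 2 fun h => hij ?_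
        rw [Nat.add_eq_zero_iff] at h
        rw [h.1, h.2]
      simp [zero_pow this]
  have hpow {n : ℕ} (hn : n ≠ 0) : ‖q ^ n‖ < 1 := by
    rw [norm_pow]; exact pow_lt_one₀ (norm_nonneg q) hq hn
  have hsum : (∑' p : ℕ × ℕ,
      (-1 : ℂ) ^ p.2 * q ^ (p.1 ^ 2 + 2 * p.1 * p.2 + p.2 ^ 2) /
        (qPoch (q ^ 8) (q ^ 8) p.1 * qPoch (q ^ 8) (q ^ 8) p.2)) =
      ∑' p, doubleTerm (q ^ 4) q (-1) p := by
    have hinj : Function.Injective (Prod.map ((↑) : ℕ → ℤ) ((↑) : ℕ → ℤ)) :=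
      Nat.cast_injective.prodMap Nat.cast_injective
    rw [← hinj.tsum_eq]
    · refine tsum_congr fun p => ?_
      simp only [doubleTerm, Prod.map_fst, Prod.map_snd, qPochRecip_natCast, ← pow_mul]
      rw [← Nat.cast_add, ← Nat.cast_pow, zpow_natCast, zpow_natCast, add_sq]
      ring
    · rintro ⟨i, j⟩ hij
      rw [Function.mem_support] at hij
      have hi : 0 ≤ i := not_lt.mp fun h => hij (doubleTerm_eq_zero (Or.inl h))
      have hj : 0 ≤ j := not_lt.mp fun h => hij (doubleTerm_eq_zero (Or.inr h))
      exact ⟨(i.toNat, j.toNat), by simp [hi, hj]⟩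
  have hR := qPochInf_mul_tsum_eq_tsum (pow_ne_zero 4 hq0) (hpow four_ne_zero)
  have hRS : ∑' n : ℤ, (q ^ 4) ^ (n ^ 2) * ∑' j, rogersSzegoTerm (q ^ 4) (q ^ 4) n j =
      ∑' k : ℤ, (q ^ 2) ^ (2 * k ^ 2) * qPochRecip (q ^ 2) k := by
    refine tsum_congr fun n => ?_
    have h := tsum_rogersSzegoTerm_sq (pow_ne_zero 2 hq0) (hpow two_ne_zero) n
    rw [← pow_mul] at h
    rw [h, zpow_mul (q ^ 2) 2]
    norm_cast
    rw [← pow_mul]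
  have hRR := tsum_rogersRamanujan (pow_ne_zero 2 hq0) (hpow two_ne_zero)
  have h5 := qPochInf_self_eq_prod_five (hpow four_ne_zero)
  rw [hsum, tsum_doubleTerm_neg_one hq0 hq]
  rw [hRS] at hR
  rw [← hR] at hRR
  simp only [← pow_mul, Nat.reduceMul] at hRR h5 ⊢
  rw [h5] at hRR
  have hne {a b : ℕ} (ha : a ≠ 0) (hb : b ≠ 0) : qPochInf (q ^ a) (q ^ b) ≠ 0 :=
    qPochInf_ne_zero_of_norm_lt_one (hpow ha) (hpow hb)
  have hN : qPochInf (-q ^ 8) (q ^ 8) ≠ 0 :=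
    qPochInf_ne_zero_of_norm_lt_one (by rw [norm_neg]; exact hpow (by norm_num))
      (hpow (by norm_num))
  have h4 := hne (a := 4) (b := 20) (by norm_num) (by norm_num)
  have h8 := hne (a := 8) (b := 20) (by norm_num) (by norm_num)
  have h12 := hne (a := 12) (b := 20) (by norm_num) (by norm_num)
  have h16 := hne (a := 16) (b := 20) (by norm_num) (by norm_num)
  have h20 := hne (a := 20) (b := 20) (by norm_num) (by norm_num)
  rw [eq_div_iff (mul_ne_zero (mul_ne_zero hN h4) h16)]
  apply mul_left_cancel₀ (mul_ne_zero (mul_ne_zero h8 h12) h20)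
  linear_combination hRR
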